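/- The maximal elements of the poset OP_Γ are exactly the pairs (E_sep, φ), where φ ranges over the totally cyclic orientations of Γ∖E_sep. -/

import Mathlib

/-!
Serre-style finite graphs: a vertex type `V`, an oriented-edge type `E` with a
fixed-point-free involution `inv` (edge reversal) and source/target maps `s, t`
with `s (inv e) = t e`.  An unoriented edge is an `inv`-orbit `{e, inv e}`;
subsets of unoriented edges are encoded as `inv`-closed subsets of `E`, and an
orientation of a spanning subgraph `Γ∖T` is encoded by the set `O` of its
positively oriented edges.  1-chains with coefficients in `A` are encoded as
functions `c : E → A` with `c (inv e) = - c e` (so that `(c, e⃗) = c e` for the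
standard bilinear form).
-/

structure SerreGraph where
  V : Type
  E : Type
  [fintypeV : Fintype V]
  [fintypeE : Fintype E]
  [decEqV : DecidableEq V]
  [decEqE : DecidableEq E]
  inv : E → E
  s : E → V
  t : E → V
  inv_inv : ∀ e, inv (inv e) = e
  inv_ne : ∀ e, inv e ≠ e
  s_inv : ∀ e, s (inv e) = t e

attribute [instance] SerreGraph.fintypeV SerreGraph.fintypeE
attribute [instance] SerreGraph.decEqV SerreGraph.decEqE

namespace SerreGraph

variable (Γ : SerreGraph)

/-- Reachability between vertices in the spanning subgraph whose allowed oriented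
edges are those in `A`. -/
def Reach (A : Set Γ.E) : Γ.V → Γ.V → Prop :=
  Relation.ReflTransGen (fun a b => ∃ e ∈ A, Γ.s e = a ∧ Γ.t e = b)

/-- The number of connected components of the spanning subgraph with allowed
oriented edges `A`. -/
noncomputable def numComponents (A : Set Γ.E) : ℕ :=
  Nat.card (Quot (fun a b : Γ.V => ∃ e ∈ A, Γ.s e = a ∧ Γ.t e = b))

/-- The set of separating (oriented) edges: removing the underlying unoriented
edge increases the number of connected components. -/
def Esep : Set Γ.E :=
  {e | Γ.numComponents Set.univ < Γ.numComponents {f | f ≠ e ∧ f ≠ Γ.inv e}}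

/-- `T` encodes a set of unoriented edges. -/
def InvClosed (T : Set Γ.E) : Prop := ∀ e, e ∈ T ↔ Γ.inv e ∈ T

/-- `O` is (the set of positively oriented edges of) an orientation of `Γ∖T`. -/
def IsOrientation (T O : Set Γ.E) : Prop :=
  (∀ e ∈ O, e ∉ T) ∧ ∀ e, e ∉ T → (e ∈ O ↔ Γ.inv e ∉ O)

/-- A totally cyclic orientation of `Γ∖T`: an orientation such that there is no
vertex set `W` which is nonempty and proper inside some connected component of
`Γ∖T` and such that all edges of `Γ∖T` crossing the boundary of `W` are oriented
out of `W` (this is the componentwise condition of the paper). -/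
def IsTotallyCyclic (T O : Set Γ.E) : Prop :=
  Γ.IsOrientation T O ∧
    ¬ ∃ W : Set Γ.V, (∃ v ∈ W, ∃ w ∈ Wᶜ, Γ.Reach Tᶜ v w) ∧
        ∀ e ∈ O, Γ.t e ∈ W → Γ.s e ∈ W

/-- `γ` is (the set of positively oriented edges of) an oriented circuit of `Γ`:
a cyclic subgraph (connected, first Betti number one, no separating edges)
together with a totally cyclic orientation; equivalently a directed cycle:
each incident vertex has exactly one outgoing and one incoming edge in `γ`,
and the support is connected. -/
def IsCircuit (γ : Finset Γ.E) : Prop :=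
  γ.Nonempty ∧ (∀ e ∈ γ, Γ.inv e ∉ γ) ∧
    (∀ v ∈ γ.image Γ.s ∪ γ.image Γ.t, ∃! e, e ∈ γ ∧ Γ.s e = v) ∧
    (∀ v ∈ γ.image Γ.s ∪ γ.image Γ.t, ∃! e, e ∈ γ ∧ Γ.t e = v) ∧
    ∀ e ∈ γ, ∀ f ∈ γ, Γ.Reach ((↑γ : Set Γ.E) ∪ Γ.inv '' ↑γ) (Γ.s e) (Γ.s f)

/-- The class `[γ] ∈ H₁(Γ,ℤ)` of an oriented circuit. -/
def circChainZ (γ : Finset Γ.E) : Γ.E → ℤ :=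
  fun e => if e ∈ γ then 1 else if Γ.inv e ∈ γ then -1 else 0

/-- The class `[γ] ∈ H₁(Γ,ℝ)` of an oriented circuit. -/
noncomputable def circChainR (γ : Finset Γ.E) : Γ.E → ℝ :=
  fun e => (Γ.circChainZ γ e : ℝ)

/-- `Cir_φ(Γ∖T)`: oriented circuits of `Γ∖T` compatibly oriented with the
orientation with positive edges `O`. -/
def Cir (T O : Set Γ.E) : Set (Finset Γ.E) :=
  {γ | Γ.IsCircuit γ ∧ (∀ e ∈ γ, e ∈ O) ∧ ∀ e ∈ γ, e ∉ T}

/-- `c` is a 1-cycle: a skew 1-chain with vanishing boundary, i.e. an element of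
`H₁(Γ,A)`. -/
def IsCycle {A : Type*} [AddCommGroup A] (c : Γ.E → A) : Prop :=
  (∀ e, c (Γ.inv e) = - c e) ∧
    ∀ v, ∑ e ∈ Finset.univ.filter (fun e => Γ.t e = v), c e = 0

/-- An element of `H₁(Γ∖T, A) ⊆ H₁(Γ,A)`: a cycle supported on edges not in `T`. -/
def IsCycleOn {A : Type*} [AddCommGroup A] (T : Set Γ.E) (c : Γ.E → A) : Prop :=
  Γ.IsCycle c ∧ ∀ e ∈ T, c e = 0

/-- The standard positive definite bilinear form on `C⃗₁(Γ,ℝ)`, for which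
`(c, e⃗) = c e`. -/
noncomputable def pair (c c' : Γ.E → ℝ) : ℝ := (∑ e, c e * c' e) / 2

/-- The first Betti number `b₁(Γ) = dim_ℝ H₁(Γ,ℝ)`. -/
noncomputable def b1 : ℕ :=
  Module.finrank ℝ (Submodule.span ℝ {c : Γ.E → ℝ | Γ.IsCycle c})

/-- `b₁(Γ∖T) = dim_ℝ H₁(Γ∖T,ℝ)`. -/
noncomputable def b1Sub (T : Set Γ.E) : ℕ :=
  Module.finrank ℝ (Submodule.span ℝ {c : Γ.E → ℝ | Γ.IsCycleOn T c})

/-- The cone `σ(T,φ) ⊆ H₁(Γ,ℝ)` of the cographic fan associated to a pair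
`(T, O)` with `O` an orientation of `Γ∖T`. -/
def sigmaCone (T O : Set Γ.E) : Set (Γ.E → ℝ) :=
  {v | Γ.IsCycle v ∧ (∀ e ∈ O, 0 ≤ v e) ∧ ∀ e ∈ T, v e = 0}

/-- The poset `OP_Γ` of totally cyclic orientations: pairs `(T, O)` with `T` a
set of unoriented edges and `O` a totally cyclic orientation of `Γ∖T`. -/
def OP : Set (Set Γ.E × Set Γ.E) :=
  {p | Γ.InvClosed p.1 ∧ Γ.IsTotallyCyclic p.1 p.2}

/-- The order on `OP_Γ`: `(T',φ') ≤ (T,φ)` iff `T' ⊇ T` and `φ'` is the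
restriction of `φ`. -/
def OPle (p q : Set Γ.E × Set Γ.E) : Prop :=
  q.1 ⊆ p.1 ∧ p.2 = q.2 ∩ p.1ᶜ

/-- `H₁(Γ,ℤ)` viewed as the set of lattice points of `H₁(Γ,ℝ)`. -/
def H1Z : Set (Γ.E → ℝ) := {c | Γ.IsCycle c ∧ ∀ e, ∃ n : ℤ, c e = (n : ℝ)}

/-- The Voronoi polytope `Vor_Γ ⊆ H₁(Γ,ℝ)`. -/
def voronoi : Set (Γ.E → ℝ) :=
  {v | Γ.IsCycle v ∧ ∀ l ∈ Γ.H1Z, Γ.pair v v ≤ Γ.pair (v - l) (v - l)}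

/-- A (exposed) face of the Voronoi polytope. -/
def IsVorFace (F : Set (Γ.E → ℝ)) : Prop :=
  ∃ l : (Γ.E → ℝ) →ₗ[ℝ] ℝ, F = {v | v ∈ Γ.voronoi ∧ ∀ w ∈ Γ.voronoi, l w ≤ l v}

/-- The face `F(T,φ)` of the Voronoi polytope associated to `(T,O) ∈ OP_Γ`. -/
def vorFace (T O : Set Γ.E) : Set (Γ.E → ℝ) :=
  {v | v ∈ Γ.voronoi ∧ ∀ γ ∈ Γ.Cir T O,
      Γ.pair v (Γ.circChainR γ) = Γ.pair (Γ.circChainR γ) (Γ.circChainR γ) / 2}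

end SerreGraph

namespace SerreGraph

variable {Γ : SerreGraph}

theorem t_inv (e : Γ.E) : Γ.t (Γ.inv e) = Γ.s e := by
  rw [← Γ.s_inv, Γ.inv_inv]

theorem inv_eq_iff {e f : Γ.E} : Γ.inv e = f ↔ e = Γ.inv f := by
  constructor
  · rintro rfl
    rw [Γ.inv_inv]
  · rintro rfl
    rw [Γ.inv_inv]

theorem Reach.mono {A B : Set Γ.E} (h : A ⊆ B) {a b : Γ.V} (hab : Γ.Reach A a b) :
    Γ.Reach B a b :=
  Relation.ReflTransGen.mono (fun _ _ ⟨e, he, h'⟩ => ⟨e, h he, h'⟩) _ _ hab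

theorem Reach.trans {A : Set Γ.E} {a b c : Γ.V} (hab : Γ.Reach A a b) (hbc : Γ.Reach A b c) :
    Γ.Reach A a c :=
  Relation.ReflTransGen.trans hab hbc

theorem Reach.of_mem {A : Set Γ.E} {e : Γ.E} (he : e ∈ A) : Γ.Reach A (Γ.s e) (Γ.t e) :=
  Relation.ReflTransGen.single ⟨e, he, rfl, rfl⟩

/-- Replacing each edge of a path by a path. -/
theorem Reach.bind {A B : Set Γ.E} (h : ∀ e ∈ A, Γ.Reach B (Γ.s e) (Γ.t e)) {a b : Γ.V}
    (hab : Γ.Reach A a b) : Γ.Reach B a b := by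
  induction hab with
  | refl => exact Relation.ReflTransGen.refl
  | tail _ hstep ih =>
    obtain ⟨e, he, rfl, rfl⟩ := hstep
    exact ih.trans (h e he)

theorem Reach.symm {A : Set Γ.E} (hA : Γ.InvClosed A) {a b : Γ.V} (hab : Γ.Reach A a b) :
    Γ.Reach A b a := by
  induction hab with
  | refl => exact Relation.ReflTransGen.refl
  | tail _ hstep ih =>
    obtain ⟨e, he, rfl, rfl⟩ := hstep
    have h := Reach.of_mem ((hA e).1 he)
    rw [Γ.s_inv, t_inv] at h
    exact h.trans ih

/-- A path can be cut at its first visit to its endpoint. -/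
theorem Reach.avoid_source {A : Set Γ.E} {a b : Γ.V} (hab : Γ.Reach A a b) :
    Γ.Reach {f ∈ A | Γ.s f ≠ b} a b := by
  induction hab using Relation.ReflTransGen.head_induction_on with
  | refl => exact Relation.ReflTransGen.refl
  | head hstep _ ih =>
    obtain ⟨e, he, rfl, rfl⟩ := hstep
    by_cases h : Γ.s e = b
    · rw [h]
      exact Relation.ReflTransGen.refl
    · exact Relation.ReflTransGen.head ⟨e, ⟨he, h⟩, rfl, rfl⟩ ih

/-- A path either avoids the edge `f`, or splits at its first and last passages through `f`. -/
theorem Reach.avoid_or_split {A : Set Γ.E} (f : Γ.E) {a b : Γ.V} (hab : Γ.Reach A a b) :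
    Γ.Reach (A \ {f}) a b ∨ (Γ.Reach (A \ {f}) a (Γ.s f) ∧ Γ.Reach (A \ {f}) (Γ.t f) b) := by
  induction hab with
  | refl => exact Or.inl Relation.ReflTransGen.refl
  | tail _ hstep ih =>
    obtain ⟨e, he, rfl, rfl⟩ := hstep
    by_cases hef : e = f
    · subst hef
      refine Or.inr ⟨?_, Relation.ReflTransGen.refl⟩
      rcases ih with h | h
      exacts [h, h.1]
    · have h := Reach.of_mem (show e ∈ A \ {f} from ⟨he, hef⟩)
      rcases ih with h' | ⟨h₁, h₂⟩
      exacts [Or.inl (h'.trans h), Or.inr ⟨h₁, h₂.trans h⟩]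

theorem quot_mk_eq_iff_reach {A : Set Γ.E} (hA : Γ.InvClosed A) {a b : Γ.V} :
    Quot.mk (fun a b : Γ.V => ∃ e ∈ A, Γ.s e = a ∧ Γ.t e = b) a =
      Quot.mk (fun a b : Γ.V => ∃ e ∈ A, Γ.s e = a ∧ Γ.t e = b) b ↔ Γ.Reach A a b := by
  rw [Quot.eq]
  constructor
  · intro h
    induction h with
    | rel _ _ h => exact Relation.ReflTransGen.single h
    | refl => exact Relation.ReflTransGen.refl
    | symm _ _ _ ih => exact ih.symm hA
    | trans _ _ _ _ _ ih₁ ih₂ => exact ih₁.trans ih₂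
  · intro h
    induction h with
    | refl => exact Relation.EqvGen.refl _
    | tail _ h ih => exact ih.trans _ _ _ (.rel _ _ h)

theorem invClosed_avoiding (e : Γ.E) : Γ.InvClosed {f | f ≠ e ∧ f ≠ Γ.inv e} := by
  intro f
  simp only [Set.mem_ofPred_eq, ne_eq, inv_eq_iff, Γ.inv_inv]
  tauto

theorem mem_Esep_iff {e : Γ.E} :
    e ∈ Γ.Esep ↔ ¬ Γ.Reach {f | f ≠ e ∧ f ≠ Γ.inv e} (Γ.s e) (Γ.t e) := by
  have hA := invClosed_avoiding e
  set A : Set Γ.E := {f | f ≠ e ∧ f ≠ Γ.inv e}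
  have hle : (Γ.numComponents A ≤ Γ.numComponents Set.univ) ↔
      Γ.Reach A (Γ.s e) (Γ.t e) := by
    constructor
    · intro hcard
      let F : Quot (fun a b : Γ.V => ∃ e ∈ A, Γ.s e = a ∧ Γ.t e = b) →
          Quot (fun a b : Γ.V => ∃ e ∈ (Set.univ : Set Γ.E), Γ.s e = a ∧ Γ.t e = b) :=
        Quot.map id fun _ _ ⟨e, _, h⟩ => ⟨e, trivial, h⟩
      have hsurj : Function.Surjective F := by
        rintro ⟨v⟩
        exact ⟨Quot.mk _ v, rfl⟩
      have hinj := (hsurj.bijective_of_nat_card_le hcard).1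
      rw [← quot_mk_eq_iff_reach hA]
      exact hinj (Quot.sound ⟨e, trivial, rfl, rfl⟩)
    · intro hreach
      have hall : ∀ f : Γ.E, Γ.Reach A (Γ.s f) (Γ.t f) := by
        intro f
        by_cases h₁ : f = e
        · rwa [h₁]
        by_cases h₂ : f = Γ.inv e
        · rw [h₂, Γ.s_inv, t_inv]
          exact hreach.symm hA
        exact Reach.of_mem ⟨h₁, h₂⟩
      let F : Quot (fun a b : Γ.V => ∃ e ∈ (Set.univ : Set Γ.E), Γ.s e = a ∧ Γ.t e = b) →
          Quot (fun a b : Γ.V => ∃ e ∈ A, Γ.s e = a ∧ Γ.t e = b) :=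
        Quot.lift (Quot.mk _) (by
          rintro _ _ ⟨f, _, rfl, rfl⟩
          exact (quot_mk_eq_iff_reach hA).2 (hall f))
      refine Nat.card_le_card_of_surjective F ?_
      rintro ⟨v⟩
      exact ⟨Quot.mk _ v, rfl⟩
  rw [← hle, not_le]
  rfl

theorem invClosed_Esep (Γ : SerreGraph) : Γ.InvClosed Γ.Esep := by
  intro e
  have h : {f | f ≠ Γ.inv e ∧ f ≠ Γ.inv (Γ.inv e)} = {f | f ≠ e ∧ f ≠ Γ.inv e} := by
    ext f
    simp only [Γ.inv_inv, Set.mem_ofPred_eq, and_comm]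
  simp only [Esep, Set.mem_ofPred_eq] at h ⊢
  rw [h]

/-- An orientation is totally cyclic iff every positive edge lies on a directed closed path. -/
theorem isTotallyCyclic_iff {T O : Set Γ.E} :
    Γ.IsTotallyCyclic T O ↔
      Γ.IsOrientation T O ∧ ∀ e ∈ O, Γ.Reach O (Γ.t e) (Γ.s e) := by
  refine and_congr_right fun hO => ⟨fun h e he => ?_, ?_⟩
  · by_contra hne
    refine h ⟨{u | Γ.Reach O u (Γ.s e)}, ⟨Γ.s e, Relation.ReflTransGen.refl, Γ.t e, hne,
      Reach.of_mem (hO.1 e he)⟩, fun f hf hreach => (Reach.of_mem hf).trans hreach⟩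
  · rintro h ⟨W, ⟨v, hv, w, hw, hvw⟩, hW⟩
    have hback : ∀ a b, Γ.Reach O a b → b ∈ W → a ∈ W := by
      intro a b hab hb
      induction hab using Relation.ReflTransGen.head_induction_on with
      | refl => exact hb
      | head hstep _ ih =>
        obtain ⟨f, hf, rfl, rfl⟩ := hstep
        exact hW f hf ih
    refine hw ?_
    induction hvw with
    | refl => exact hv
    | tail _ hstep ih =>
      obtain ⟨f, hf, rfl, rfl⟩ := hstep
      have hs : Γ.s f ∈ W := by
        by_contra hs
        exact hs (ih hs)
      by_cases hfO : f ∈ O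
      · exact hback _ _ (h f hfO) hs
      · have hinv : Γ.inv f ∈ O := by
          by_contra hinv
          exact hfO ((hO.2 f hf).2 hinv)
        rw [← Γ.s_inv]
        refine hW _ hinv ?_
        rwa [t_inv]

theorem IsTotallyCyclic.reach {T O : Set Γ.E} (h : Γ.IsTotallyCyclic T O) {f : Γ.E}
    (hf : f ∉ T) : Γ.Reach O (Γ.s f) (Γ.t f) := by
  obtain ⟨hO, hcyc⟩ := isTotallyCyclic_iff.1 h
  by_cases hfO : f ∈ O
  · exact Reach.of_mem hfO
  · have hinv : Γ.inv f ∈ O := by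
      by_contra hinv
      exact hfO ((hO.2 f hf).2 hinv)
    have := hcyc _ hinv
    rwa [t_inv, Γ.s_inv] at this

theorem IsTotallyCyclic.Esep_subset {T O : Set Γ.E} (h : Γ.IsTotallyCyclic T O) :
    Γ.Esep ⊆ T := by
  obtain ⟨hO, hcyc⟩ := isTotallyCyclic_iff.1 h
  have hpos : ∀ e ∈ O, e ∉ Γ.Esep := by
    intro e he hsep
    refine mem_Esep_iff.1 hsep (Reach.symm (invClosed_avoiding e) ?_)
    refine (hcyc e he).avoid_source.mono ?_
    rintro f ⟨hf, hfs⟩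
    refine ⟨fun hfe => hfs (hfe ▸ rfl), fun hfe => ?_⟩
    exact (hO.2 e (hO.1 e he)).1 he (hfe ▸ hf)
  intro e he
  by_contra heT
  by_cases heO : e ∈ O
  · exact hpos e heO he
  · refine heO ((hO.2 e heT).2 fun hinv => ?_)
    exact hpos _ hinv ((invClosed_Esep Γ e).1 he)

/-- A totally cyclic orientation of `Γ∖T` extends over a non-separating edge of `T`, by
orienting a directed ear through that edge. -/
theorem exists_OPle_of_not_mem_Esep {T O : Set Γ.E} (hT : Γ.InvClosed T)
    (h : Γ.IsTotallyCyclic T O) {e : Γ.E} (heT : e ∈ T) (he : e ∉ Γ.Esep) :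
    ∃ q ∈ Γ.OP, Γ.OPle (T, O) q ∧ e ∉ q.1 := by
  obtain ⟨hO, hcyc⟩ := isTotallyCyclic_iff.1 h
  have hex : ∃ Y : Set Γ.E, Y ⊆ {f ∈ T | f ≠ e ∧ f ≠ Γ.inv e} ∧
      Γ.Reach (O ∪ Y) (Γ.t e) (Γ.s e) := by
    refine ⟨_, subset_rfl, ?_⟩
    have hr := (not_not.1 (mem_Esep_iff.not.1 he)).symm (invClosed_avoiding e)
    refine hr.bind fun f hf => ?_
    by_cases hfT : f ∈ T
    · exact Reach.of_mem (Or.inr ⟨hfT, hf⟩)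
    · exact (h.reach hfT).mono Set.subset_union_left
  obtain ⟨Y, ⟨hYT, hY⟩, hmin⟩ := (Set.toFinite {Y : Set Γ.E |
    Y ⊆ {f ∈ T | f ≠ e ∧ f ≠ Γ.inv e} ∧ Γ.Reach (O ∪ Y) (Γ.t e) (Γ.s e)}).exists_minimal hex
  have hneed : ∀ f ∈ Y, ¬ Γ.Reach ((O ∪ Y) \ {f}) (Γ.t e) (Γ.s e) := by
    intro f hf hr
    refine (hmin (y := Y \ {f}) ⟨Set.sdiff_subset.trans hYT, hr.mono ?_⟩
      Set.sdiff_subset hf).2 rfl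
    rintro g ⟨hg | hg, hgf⟩
    exacts [Or.inl hg, Or.inr ⟨hg, hgf⟩]
  have hsplit : ∀ f ∈ Y, Γ.Reach ((O ∪ Y) \ {f}) (Γ.t e) (Γ.s f) ∧
      Γ.Reach ((O ∪ Y) \ {f}) (Γ.t f) (Γ.s e) :=
    fun f hf => (hY.avoid_or_split f).resolve_left (hneed f hf)
  have hYinv : ∀ f ∈ Y, Γ.inv f ∉ Y := by
    intro f hf hg
    rcases (hsplit f hf).2.avoid_or_split (Γ.inv f) with h₁ | ⟨-, h₁⟩
    · refine hneed _ hg ((hsplit _ hg).1.trans ?_)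
      rw [Γ.s_inv]
      exact h₁.mono (Set.sdiff_subset_sdiff_left Set.sdiff_subset)
    · rw [t_inv] at h₁
      exact hneed f hf ((hsplit f hf).1.trans (h₁.mono Set.sdiff_subset))
  set X : Set Γ.E := insert e Y
  have hXT : X ⊆ T := Set.insert_subset heT fun f hf => (hYT hf).1
  have hXinv : ∀ f ∈ X, Γ.inv f ∉ X := by
    rintro f (rfl | hf) (hg | hg)
    · exact Γ.inv_ne _ hg
    · exact (hYT hg).2.2 rfl
    · exact (hYT hf).2.2 (inv_eq_iff.1 hg)
    · exact hYinv f hf hg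
  have heX : e ∈ X := Set.mem_insert _ _
  have hOY : O ∪ Y ⊆ O ∪ X := Set.union_subset_union_right _ (Set.subset_insert _ _)
  refine ⟨({f ∈ T | f ∉ X ∧ Γ.inv f ∉ X}, O ∪ X), ⟨?_, isTotallyCyclic_iff.2 ⟨⟨?_, ?_⟩, ?_⟩⟩,
    ⟨fun f hf => hf.1, ?_⟩, fun h' => h'.2.1 heX⟩
  · intro f
    simp only [Set.mem_ofPred_eq, Γ.inv_inv, ← hT f]
    tauto
  · rintro f (hf | hf) ⟨hfT, hfX, -⟩
    exacts [hO.1 f hf hfT, hfX hf]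
  · intro f hf
    by_cases hfT : f ∈ T
    · have h₁ : f ∉ O := fun h' => hO.1 f h' hfT
      have h₂ : Γ.inv f ∉ O := fun h' => hO.1 _ h' ((hT f).1 hfT)
      simp only [Set.mem_union, h₁, h₂, false_or]
      exact ⟨hXinv f, fun h' => by_contra fun h'' => hf ⟨hfT, h'', h'⟩⟩
    · have h₁ : f ∉ X := fun h' => hfT (hXT h')
      have h₂ : Γ.inv f ∉ X := fun h' => hfT ((hT f).2 (hXT h'))
      simp only [Set.mem_union, h₁, h₂, or_false]
      exact hO.2 f hfT
  · rintro f (hf | rfl | hf)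
    · exact (hcyc f hf).mono Set.subset_union_left
    · exact hY.mono hOY
    · exact ((hsplit f hf).2.mono (Set.sdiff_subset.trans hOY)).trans
        ((Reach.of_mem (Or.inr heX)).trans ((hsplit f hf).1.mono (Set.sdiff_subset.trans hOY)))
  · ext f
    have h₂ := hO.1 f
    have h₆ := @hXT f
    simp only [Set.mem_inter_iff, Set.mem_union, Set.mem_compl_iff]
    tauto

end SerreGraph

/-- The maximal elements of `OP_Γ` are exactly the pairs
`(E_sep, φ)` with `φ` a totally cyclic orientation of `Γ∖E_sep`. -/
theorem stmt4 (Γ : SerreGraph) :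
    (∀ O : Set Γ.E, Γ.IsTotallyCyclic Γ.Esep O → (Γ.Esep, O) ∈ Γ.OP) ∧
    ∀ p ∈ Γ.OP, ((∀ q ∈ Γ.OP, Γ.OPle p q → q = p) ↔ p.1 = Γ.Esep) := by
  refine ⟨fun O hO => ⟨Γ.invClosed_Esep, hO⟩, ?_⟩
  rintro ⟨T, O⟩ ⟨hT, hO⟩
  constructor
  · intro hmax
    refine Set.Subset.antisymm (fun e heT => ?_) (hO.Esep_subset)
    by_contra he
    obtain ⟨q, hq, hle, heq⟩ := SerreGraph.exists_OPle_of_not_mem_Esep hT hO heT he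
    rw [hmax q hq hle] at heq
    exact heq heT
  · rintro rfl ⟨T', O'⟩ ⟨hT', hO'⟩ ⟨hsub, hres⟩
    have hTT' : T' = Γ.Esep := Set.Subset.antisymm hsub (hO'.Esep_subset)
    subst hTT'
    have hOO' : O = O' := hres.trans (Set.inter_eq_left.2 hO'.1.1)
    rw [hOO']
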